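/- Let x_1, ..., x_N ∈ ℝ^D, let t ∈ {1,...,K}^N be an assignment vector with n_k := |{n : t_n = k}| ≥ 1 for all k, let U ∈ ℝ^{K×D} have k-th row u_k = (1/n_k) Σ_{n : t_n = k} x_n, let D_{√n} ∈ ℝ^{K×K} be the diagonal matrix with diagonal entries √(n_k), and set A := D_{√n} U. Then for any subset 𝒱 ⊆ ℝ^{K×D} and any V* ∈ 𝒱, V* minimizes V ↦ Σ_{k=1}^K Σ_{n : t_n = k} ‖x_n − v_k‖² over 𝒱 (where v_k is the k-th row of V) if and only if V* minimizes V ↦ ‖A − D_{√n} V‖_F² over 𝒱. -/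

import Mathlib

open scoped BigOperators

attribute [local instance] Matrix.frobeniusNormedAddCommGroup

/-- For a fixed assignment with nonempty clusters, minimizing the K-means
objective over a set `𝒱` of centroid matrices (given by their rows) is equivalent to
minimizing the Frobenius approximation error `‖A - D_{√n} V‖_F²` over `𝒱`,
where `A = D_{√n} U` and `U` is the matrix of cluster means. -/
theorem kmeans_centroid_update_iff_weighted_frobenius_min
    {N D K : ℕ} (x : Fin N → EuclideanSpace ℝ (Fin D))
    (t : Fin N → Fin K)
    (nk : Fin K → ℕ)
    (hnk : ∀ k : Fin K, nk k = (Finset.univ.filter fun n => t n = k).card)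
    (hpos : ∀ k : Fin K, 1 ≤ nk k)
    (u : Fin K → EuclideanSpace ℝ (Fin D))
    (hu : ∀ k : Fin K,
      u k = (nk k : ℝ)⁻¹ • ∑ n ∈ Finset.univ.filter fun n => t n = k, x n)
    (A : Matrix (Fin K) (Fin D) ℝ)
    (hA : A = (Matrix.diagonal fun k => Real.sqrt (nk k)) *
            Matrix.of (fun (k : Fin K) (d : Fin D) => u k d))
    (𝒱 : Set (Fin K → EuclideanSpace ℝ (Fin D)))
    (Vstar : Fin K → EuclideanSpace ℝ (Fin D)) (hVstar : Vstar ∈ 𝒱) :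
    (∀ V ∈ 𝒱,
        ∑ k : Fin K, ∑ n ∈ Finset.univ.filter fun n => t n = k, ‖x n - Vstar k‖ ^ 2
          ≤ ∑ k : Fin K, ∑ n ∈ Finset.univ.filter fun n => t n = k, ‖x n - V k‖ ^ 2)
      ↔ (∀ V ∈ 𝒱,
        ‖A - (Matrix.diagonal fun k => Real.sqrt (nk k)) *
            Matrix.of (fun (k : Fin K) (d : Fin D) => Vstar k d)‖ ^ 2
          ≤ ‖A - (Matrix.diagonal fun k => Real.sqrt (nk k)) *
            Matrix.of (fun (k : Fin K) (d : Fin D) => V k d)‖ ^ 2) := by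
  have hF : ∀ M : Matrix (Fin K) (Fin D) ℝ, ‖M‖ ^ 2 = ∑ k, ∑ d, (M k d) ^ 2 := by
    intro M
    have h0 : 0 ≤ ∑ k, ∑ d, (M k d) ^ 2 :=
      Finset.sum_nonneg fun k _ => Finset.sum_nonneg fun d _ => sq_nonneg _
    rw [Matrix.frobenius_norm_def]
    simp only [Real.rpow_two, Real.norm_eq_abs, sq_abs]
    rw [← Real.sqrt_eq_rpow, Real.sq_sqrt h0]
  have hV : ∀ V : Fin K → EuclideanSpace ℝ (Fin D),
      ‖A - (Matrix.diagonal fun k => Real.sqrt (nk k)) *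
            Matrix.of (fun (k : Fin K) (d : Fin D) => V k d)‖ ^ 2
        = ∑ k, (nk k : ℝ) * ‖u k - V k‖ ^ 2 := by
    intro V
    rw [hF]
    refine Finset.sum_congr rfl fun k _ => ?_
    rw [EuclideanSpace.norm_sq_eq, Finset.mul_sum]
    refine Finset.sum_congr rfl fun d _ => ?_
    rw [hA, Matrix.sub_apply, Matrix.diagonal_mul, Matrix.diagonal_mul, ← mul_sub, mul_pow,
      Real.sq_sqrt (Nat.cast_nonneg _)]
    simp
  have hO : ∀ V : Fin K → EuclideanSpace ℝ (Fin D),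
      ∑ k : Fin K, ∑ n ∈ Finset.univ.filter fun n => t n = k, ‖x n - V k‖ ^ 2
        = (∑ k : Fin K, ∑ n ∈ Finset.univ.filter fun n => t n = k, ‖x n - u k‖ ^ 2)
          + ∑ k, (nk k : ℝ) * ‖u k - V k‖ ^ 2 := by
    intro V
    rw [← Finset.sum_add_distrib]
    refine Finset.sum_congr rfl fun k _ => ?_
    have hn : (nk k : ℝ) ≠ 0 := by
      have := hpos k
      positivity
    have hz : ∑ n ∈ Finset.univ.filter (fun n => t n = k), (x n - u k) = 0 := by
      rw [Finset.sum_sub_distrib, Finset.sum_const, ← hnk k, hu k, ← Nat.cast_smul_eq_nsmul ℝ,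
        smul_smul, mul_inv_cancel₀ hn, one_smul, sub_self]
    have hx : ∀ n, ‖x n - V k‖ ^ 2
        = ‖x n - u k‖ ^ 2 + 2 * inner ℝ (x n - u k) (u k - V k) + ‖u k - V k‖ ^ 2 := by
      intro n
      rw [← norm_add_sq_real, sub_add_sub_cancel]
    simp only [hx]
    rw [Finset.sum_add_distrib, Finset.sum_add_distrib, ← Finset.mul_sum, ← sum_inner, hz,
      inner_zero_left, Finset.sum_const, ← hnk k, nsmul_eq_mul]
    ring
  simp only [hV]
  refine forall₂_congr fun V _ => ?_
  rw [hO V, hO Vstar, add_le_add_iff_left]
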